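/- arXiv:0912.3894 — 2 statements merged into one kernel-verified Lean document; each statement's English description precedes it below -/
import Mathlib

section
/- Let a = π/8, Δ = Δ_sq(π/8), Λ = (π/2)ℤ × (π/2)ℤ × 2πℤ, τ₀(x,y,z) = (−y, x, z + π/2), and let Γ₄ be the group of isometries of (ℝ³, h) generated by the translations by Λ and by τ₀ (so ℝ³/Γ₄ is the orientable Bieberbach manifold C₄ with the singular metric g_c). Then: (i) the systole of (C₄, g_c), i.e. the infimum of L_Δ(γ) over all g ∈ Γ₄ \ {id}, m ∈ ℝ³, and piecewise C¹ curves γ from m to g(m), equals π/2; and (ii) with V := 2π · ∫_{[−π/8, π/8]²} cos(‖p‖) dp, the Riemannian volume of (C₄, g_c), one has (π/2)³ > V. Hence the systolic ratio of (C₄, g_c) is strictly greater than 1, the optimal systolic ratio among flat metrics on C₄. -/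
open Real MeasureTheory Set

noncomputable section

/-- The point `(x, y)` of the Euclidean plane. -/
def pt2 (x y : ℝ) : EuclideanSpace ℝ (Fin 2) := (WithLp.equiv 2 (Fin 2 → ℝ)).symm ![x, y]

/-- `f : [0,1] → ℝ` is piecewise `C¹`. -/
def PC1 (f : ℝ → ℝ) : Prop :=
  ∃ (n : ℕ) (t : ℕ → ℝ), t 0 = 0 ∧ t n = 1 ∧ (∀ i < n, t i < t (i + 1)) ∧
    ContinuousOn f (Set.Icc 0 1) ∧ ∀ i < n, ContDiffOn ℝ 1 f (Set.Icc (t i) (t (i + 1)))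

/-- Length of `γ = (γ₁,γ₂,γ₃)` for the singular metric
`h = dx² + dy² + cos²(dist((x,y),Δ)) dz²`. -/
def sLen (Δ : Set (EuclideanSpace ℝ (Fin 2))) (γ₁ γ₂ γ₃ : ℝ → ℝ) : ℝ :=
  ∫ t in (0:ℝ)..1, Real.sqrt ((deriv γ₁ t) ^ 2 + (deriv γ₂ t) ^ 2 +
    Real.cos (Metric.infDist (pt2 (γ₁ t) (γ₂ t)) Δ) ^ 2 * (deriv γ₃ t) ^ 2)

/-- The square lattice `Δ_sq(a) = 2aℤ × 2aℤ ⊂ ℝ²`. -/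
def ΔsqE (a : ℝ) : Set (EuclideanSpace ℝ (Fin 2)) :=
  {p | ∃ m n : ℤ, p = pt2 (2 * a * m) (2 * a * n)}

/-- The spatial lattice `Λ = (π/2)ℤ × (π/2)ℤ × 2πℤ ⊂ ℝ³` (i.e. `4aℤ × 4aℤ × 2πℤ` with
`a = π/8`). -/
def Λsq3 : Set (ℝ × ℝ × ℝ) :=
  {w | ∃ k₁ k₂ k₃ : ℤ, w = (π / 2 * k₁, π / 2 * k₂, 2 * π * k₃)}

/-- The square `[−a,a]² ⊂ ℝ²` (Voronoi cell of `0` for `Δ_sq(a)`). -/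
def sqCell (a : ℝ) : Set (EuclideanSpace ℝ (Fin 2)) :=
  {p | p 0 ∈ Set.Icc (-a) a ∧ p 1 ∈ Set.Icc (-a) a}

/-- The screw motion `τ₀(x,y,z) = (−y, x, z + π/2)`, as a bijection of `ℝ³`. -/
def tau0Perm : Equiv.Perm (ℝ × ℝ × ℝ) where
  toFun p := (-p.2.1, p.1, p.2.2 + π / 2)
  invFun p := (p.2.1, -p.1, p.2.2 - π / 2)
  left_inv := by rintro ⟨x, y, z⟩; simp
  right_inv := by rintro ⟨x, y, z⟩; simp

/-- The group `Γ₄` of isometries of `(ℝ³, h)` generated by the translations by `Λ` and by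
`τ₀`; `ℝ³/Γ₄` is the Bieberbach manifold `C₄` with the singular metric `g_c`. -/
def Γ₄ : Subgroup (Equiv.Perm (ℝ × ℝ × ℝ)) :=
  Subgroup.closure ((fun w => Equiv.addLeft w) '' Λsq3 ∪ {tau0Perm})


lemma pt2_dist (x y u v : ℝ) : dist (pt2 x y) (pt2 u v) = √((x - u) ^ 2 + (y - v) ^ 2) := by
  simp [pt2, EuclideanSpace.dist_eq, Fin.sum_univ_two, Real.dist_eq, sq_abs]

lemma continuous_pt2 : Continuous fun p : ℝ × ℝ => pt2 p.1 p.2 := by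
  unfold pt2
  refine (PiLp.continuous_toLp 2 (fun _ : Fin 2 => ℝ)).comp ?_
  refine continuous_pi fun i => ?_
  fin_cases i
  · exact continuous_fst
  · exact continuous_snd

/-- A piecewise `C¹` function is differentiable with bounded derivative off a countable set. -/
lemma PC1.exists_bound_deriv {f : ℝ → ℝ} (hf : PC1 f) :
    ∃ S : Set ℝ, S.Countable ∧ ∃ M : ℝ, ∀ x ∈ Ioo (0 : ℝ) 1 \ S,
      DifferentiableAt ℝ f x ∧ |deriv f x| ≤ M := by
  obtain ⟨n, t, h0, h1, hlt, -, hd⟩ := hf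
  have hM : ∀ i, ∃ M : ℝ, i < n → ∀ x ∈ Ioo (t i) (t (i + 1)), |deriv f x| ≤ M := by
    intro i
    by_cases hi : i < n
    · have hc := (hd i hi).continuousOn_derivWithin (uniqueDiffOn_Icc (hlt i hi)) le_rfl
      obtain ⟨M, hM⟩ := isCompact_Icc.exists_bound_of_continuousOn hc
      refine ⟨M, fun _ x hx => ?_⟩
      rw [← derivWithin_of_mem_nhds (Icc_mem_nhds hx.1 hx.2)]
      exact hM x (Ioo_subset_Icc_self hx)
    · exact ⟨0, fun h => absurd h hi⟩
  choose M hM using hM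
  refine ⟨range t, countable_range t, ∑ i ∈ Finset.range n, |M i|, fun x hx => ?_⟩
  have hex : ∀ j ≤ n, x < t j → ∃ i < j, x ∈ Ioo (t i) (t (i + 1)) := by
    intro j
    induction j with
    | zero => intro _ h; rw [h0] at h; exact absurd h (not_lt.2 hx.1.1.le)
    | succ j ih =>
      intro hj h
      rcases lt_trichotomy x (t j) with h' | h' | h'
      · obtain ⟨i, hi, hxi⟩ := ih (by omega) h'
        exact ⟨i, by omega, hxi⟩
      · exact absurd ⟨j, h'.symm⟩ hx.2
      · exact ⟨j, by omega, h', h⟩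
  obtain ⟨i, hi, hxi⟩ := hex n le_rfl (h1 ▸ hx.1.2)
  refine ⟨((hd i hi).differentiableOn one_ne_zero).differentiableAt (Icc_mem_nhds hxi.1 hxi.2), ?_⟩
  exact (hM i hi x hxi).trans ((le_abs_self _).trans
    (Finset.single_le_sum (f := fun i => |M i|) (fun _ _ => abs_nonneg _) (Finset.mem_range.2 hi)))

lemma PC1.continuousOn {f : ℝ → ℝ} (hf : PC1 f) : ContinuousOn f (Icc 0 1) := by
  obtain ⟨_, _, -, -, -, h, -⟩ := hf
  exact h

lemma PC1.of_contDiff {f : ℝ → ℝ} (hf : ContDiff ℝ 1 f) : PC1 f :=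
  ⟨1, fun i => i, by simp, by simp, by simp, hf.continuous.continuousOn,
    fun _ _ => hf.contDiffOn⟩

/-- The speed of a curve for the singular metric. -/
def sSpeed (Δ : Set (EuclideanSpace ℝ (Fin 2))) (γ₁ γ₂ γ₃ : ℝ → ℝ) (t : ℝ) : ℝ :=
  √((deriv γ₁ t) ^ 2 + (deriv γ₂ t) ^ 2 +
    Real.cos (Metric.infDist (pt2 (γ₁ t) (γ₂ t)) Δ) ^ 2 * (deriv γ₃ t) ^ 2)

lemma sSpeed_nonneg (Δ : Set (EuclideanSpace ℝ (Fin 2))) (γ₁ γ₂ γ₃ : ℝ → ℝ) (t : ℝ) :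
    0 ≤ sSpeed Δ γ₁ γ₂ γ₃ t := Real.sqrt_nonneg _

lemma ae_restrict_Ioc_of_Ioo_diff {a b : ℝ} {S : Set ℝ} (hS : S.Countable) {p : ℝ → Prop}
    (h : ∀ x ∈ Ioo a b \ S, p x) : ∀ᵐ x ∂volume.restrict (Ioc a b), p x := by
  rw [ae_restrict_iff' measurableSet_Ioc]
  filter_upwards [hS.ae_notMem volume, (countable_singleton b).ae_notMem volume]
    with x hx hxb hxI
  exact h x ⟨⟨hxI.1, lt_of_le_of_ne hxI.2 hxb⟩, hx⟩

lemma intervalIntegrable_sSpeed (Δ : Set (EuclideanSpace ℝ (Fin 2))) {γ₁ γ₂ γ₃ : ℝ → ℝ}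
    (h₁ : PC1 γ₁) (h₂ : PC1 γ₂) (h₃ : PC1 γ₃) :
    IntervalIntegrable (sSpeed Δ γ₁ γ₂ γ₃) volume 0 1 := by
  obtain ⟨S₁, hS₁, M₁, hM₁⟩ := h₁.exists_bound_deriv
  obtain ⟨S₂, hS₂, M₂, hM₂⟩ := h₂.exists_bound_deriv
  obtain ⟨S₃, hS₃, M₃, hM₃⟩ := h₃.exists_bound_deriv
  rw [intervalIntegrable_iff_integrableOn_Ioc_of_le zero_le_one]
  have hmeas : AEStronglyMeasurable (sSpeed Δ γ₁ γ₂ γ₃) (volume.restrict (Ioc 0 1)) := by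
    have hc : ContinuousOn (fun t => Real.cos (Metric.infDist (pt2 (γ₁ t) (γ₂ t)) Δ) ^ 2)
        (Icc 0 1) := by
      have := continuous_pt2.comp_continuousOn (h₁.continuousOn.prodMk h₂.continuousOn)
      exact (Real.continuous_cos.comp_continuousOn
        ((Metric.continuous_infDist_pt Δ).comp_continuousOn this)).pow 2
    have hcm := ((hc.mono Ioc_subset_Icc_self).aestronglyMeasurable measurableSet_Ioc
      (μ := volume)).aemeasurable
    have := (((measurable_deriv γ₁).pow_const 2).add
      ((measurable_deriv γ₂).pow_const 2)).aemeasurable (μ := volume.restrict (Ioc 0 1))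
    exact ((this.add (hcm.mul ((measurable_deriv γ₃).pow_const 2).aemeasurable)).sqrt
      ).aestronglyMeasurable
  refine Integrable.of_bound hmeas √(M₁ ^ 2 + M₂ ^ 2 + M₃ ^ 2) ?_
  refine ae_restrict_Ioc_of_Ioo_diff ((hS₁.union hS₂).union hS₃) fun x hx => ?_
  obtain ⟨hx, hxS⟩ := hx
  simp only [mem_union, not_or] at hxS
  rw [Real.norm_of_nonneg (sSpeed_nonneg ..)]
  refine Real.sqrt_le_sqrt ?_
  have e₁ := sq_le_sq' (abs_le.1 (hM₁ x ⟨hx, hxS.1.1⟩).2).1 (abs_le.1 (hM₁ x ⟨hx, hxS.1.1⟩).2).2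
  have e₂ := sq_le_sq' (abs_le.1 (hM₂ x ⟨hx, hxS.1.2⟩).2).1 (abs_le.1 (hM₂ x ⟨hx, hxS.1.2⟩).2).2
  have e₃ := sq_le_sq' (abs_le.1 (hM₃ x ⟨hx, hxS.2⟩).2).1 (abs_le.1 (hM₃ x ⟨hx, hxS.2⟩).2).2
  have := mul_le_mul (Real.cos_sq_le_one (Metric.infDist (pt2 (γ₁ x) (γ₂ x)) Δ)) e₃
    (sq_nonneg _) zero_le_one
  linarith

/-- The increment of a function is at most the integral of a bound for its derivative. -/
lemma abs_sub_le_integral_of_abs_deriv_le {F g : ℝ → ℝ} {a b : ℝ} {S : Set ℝ} (hab : a ≤ b)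
    (hS : S.Countable) (hF : ContinuousOn F (Icc a b))
    (hd : ∀ x ∈ Ioo a b \ S, DifferentiableAt ℝ F x ∧ |deriv F x| ≤ g x)
    (hg : IntervalIntegrable g volume a b) : |F b - F a| ≤ ∫ t in a..b, g t := by
  have hae := ae_restrict_Ioc_of_Ioo_diff hS fun x hx => (hd x hx).2
  have hi : IntervalIntegrable (deriv F) volume a b := by
    rw [intervalIntegrable_iff_integrableOn_Ioc_of_le hab] at hg ⊢
    exact hg.mono' (measurable_deriv F).aestronglyMeasurable hae
  rw [← integral_eq_of_hasDerivAt_off_countable_of_le F (deriv F) hab hS hF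
    (fun x hx => (hd x hx).1.hasDerivAt) hi]
  exact intervalIntegral.norm_integral_le_of_norm_le (f := deriv F) hab
    ((ae_restrict_iff' measurableSet_Ioc).1 hae) hg

/-- The increment along a curve of a function which is `1`-Lipschitz for the singular metric is at
most the length of the curve. -/
lemma abs_sub_le_integral_sSpeed {Δ : Set (EuclideanSpace ℝ (Fin 2))} {γ₁ γ₂ γ₃ F : ℝ → ℝ}
    (h₁ : PC1 γ₁) (h₂ : PC1 γ₂) (h₃ : PC1 γ₃) {a b C : ℝ} (ha : 0 ≤ a) (hab : a ≤ b) (hb : b ≤ 1)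
    (hF : ContinuousOn F (Icc a b))
    (hd : ∀ x ∈ Icc (0 : ℝ) 1, DifferentiableAt ℝ γ₁ x → DifferentiableAt ℝ γ₂ x →
      DifferentiableAt ℝ γ₃ x → DifferentiableAt ℝ F x ∧ |deriv F x| ≤ C * sSpeed Δ γ₁ γ₂ γ₃ x) :
    |F b - F a| ≤ C * ∫ t in a..b, sSpeed Δ γ₁ γ₂ γ₃ t := by
  obtain ⟨S₁, hS₁, M₁, hM₁⟩ := h₁.exists_bound_deriv
  obtain ⟨S₂, hS₂, M₂, hM₂⟩ := h₂.exists_bound_deriv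
  obtain ⟨S₃, hS₃, M₃, hM₃⟩ := h₃.exists_bound_deriv
  rw [← intervalIntegral.integral_const_mul]
  refine abs_sub_le_integral_of_abs_deriv_le hab ((hS₁.union hS₂).union hS₃) hF
    (fun x hx => ?_) (((intervalIntegrable_sSpeed Δ h₁ h₂ h₃).mono_set ?_).const_mul C)
  · obtain ⟨hx, hxS⟩ := hx
    simp only [mem_union, not_or] at hxS
    have hx' : x ∈ Ioo (0 : ℝ) 1 := ⟨ha.trans_lt hx.1, hx.2.trans_le hb⟩
    exact hd x (Ioo_subset_Icc_self hx') (hM₁ x ⟨hx', hxS.1.1⟩).1 (hM₂ x ⟨hx', hxS.1.2⟩).1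
      (hM₃ x ⟨hx', hxS.2⟩).1
  · rw [uIcc_of_le hab, uIcc_of_le zero_le_one]
    exact Icc_subset_Icc ha hb

/-- The projection to the plane does not increase lengths. -/
lemma planar_dist_le_integral_sSpeed (Δ : Set (EuclideanSpace ℝ (Fin 2))) {γ₁ γ₂ γ₃ : ℝ → ℝ}
    (h₁ : PC1 γ₁) (h₂ : PC1 γ₂) (h₃ : PC1 γ₃) {a b : ℝ} (ha : 0 ≤ a) (hab : a ≤ b) (hb : b ≤ 1) :
    √((γ₁ b - γ₁ a) ^ 2 + (γ₂ b - γ₂ a) ^ 2) ≤ ∫ t in a..b, sSpeed Δ γ₁ γ₂ γ₃ t := by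
  set u := γ₁ b - γ₁ a with hu
  set v := γ₂ b - γ₂ a with hv
  have hI : Icc a b ⊆ Icc 0 1 := Icc_subset_Icc ha hb
  have key := abs_sub_le_integral_sSpeed (Δ := Δ) (F := fun t => u * γ₁ t + v * γ₂ t)
    (C := √(u ^ 2 + v ^ 2)) h₁ h₂ h₃ ha hab hb
    ((continuousOn_const.mul (h₁.continuousOn.mono hI)).add
      (continuousOn_const.mul (h₂.continuousOn.mono hI)))
    (by
      intro x _ d₁ d₂ d₃
      have hd := (d₁.hasDerivAt.const_mul u).add (d₂.hasDerivAt.const_mul v)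
      refine ⟨hd.differentiableAt, ?_⟩
      have hd' : deriv (fun t => u * γ₁ t + v * γ₂ t) x = u * deriv γ₁ x + v * deriv γ₂ x :=
        hd.deriv
      rw [hd', sSpeed, ← Real.sqrt_mul (by positivity)]
      refine Real.abs_le_sqrt ?_
      have : 0 ≤ (u ^ 2 + v ^ 2) *
        (Real.cos (Metric.infDist (pt2 (γ₁ x) (γ₂ x)) Δ) ^ 2 * (deriv γ₃ x) ^ 2) := by positivity
      nlinarith [sq_nonneg (u * deriv γ₂ x - v * deriv γ₁ x)])
  have e : (u * γ₁ b + v * γ₂ b) - (u * γ₁ a + v * γ₂ a) = √(u ^ 2 + v ^ 2) * √(u ^ 2 + v ^ 2) := by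
    rw [Real.mul_self_sqrt (by positivity), hu, hv]; ring
  simp only [e] at key
  rw [abs_of_nonneg (by positivity)] at key
  rcases (Real.sqrt_nonneg (u ^ 2 + v ^ 2)).eq_or_lt with h | h
  · rw [← h]
    exact intervalIntegral.integral_nonneg hab fun t _ => sSpeed_nonneg ..
  · exact le_of_mul_le_mul_left key h

lemma infDist_ΔsqE_le_dist (x y : ℝ) (m n : ℤ) :
    Metric.infDist (pt2 x y) (ΔsqE (π / 8)) ≤ √((x - π / 4 * m) ^ 2 + (y - π / 4 * n) ^ 2) := by
  rw [← pt2_dist]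
  exact Metric.infDist_le_dist_of_mem ⟨m, n, by congr 1 <;> ring⟩

lemma infDist_ΔsqE_le_one (x y : ℝ) : Metric.infDist (pt2 x y) (ΔsqE (π / 8)) ≤ 1 := by
  refine (infDist_ΔsqE_le_dist x y (round (x / (π / 4))) (round (y / (π / 4)))).trans ?_
  have h : ∀ w : ℝ, (w - π / 4 * round (w / (π / 4))) ^ 2 ≤ 1 / 4 := by
    intro w
    have h1 := abs_sub_round (w / (π / 4))
    have h2 : w - π / 4 * round (w / (π / 4)) = π / 4 * (w / (π / 4) - round (w / (π / 4))) := by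
      field_simp
    rw [h2, mul_pow, ← sq_abs (_ - _)]
    have h3 : (π / 4) ^ 2 ≤ 1 := by nlinarith [pi_pos, pi_le_four]
    have h4 : |w / (π / 4) - round (w / (π / 4))| ^ 2 ≤ 1 / 4 := by
      nlinarith [abs_nonneg (w / (π / 4) - round (w / (π / 4)))]
    nlinarith [sq_nonneg |w / (π / 4) - round (w / (π / 4))|]
  refine Real.sqrt_le_one.2 ?_
  linarith [h x, h y]

/-- Vertical displacement bounds the length, since the vertical factor is at least `1/2`. -/
lemma vertical_dist_le_integral_sSpeed {γ₁ γ₂ γ₃ : ℝ → ℝ}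
    (h₁ : PC1 γ₁) (h₂ : PC1 γ₂) (h₃ : PC1 γ₃) :
    |γ₃ 1 - γ₃ 0| ≤ 2 * ∫ t in (0 : ℝ)..1, sSpeed (ΔsqE (π / 8)) γ₁ γ₂ γ₃ t := by
  refine abs_sub_le_integral_sSpeed h₁ h₂ h₃ le_rfl zero_le_one le_rfl h₃.continuousOn ?_
  intro x _ _ _ d₃
  refine ⟨d₃, ?_⟩
  have hc : 1 / 2 ≤ Real.cos (Metric.infDist (pt2 (γ₁ x) (γ₂ x)) (ΔsqE (π / 8))) := by
    rw [← Real.cos_pi_div_three]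
    exact Real.cos_le_cos_of_nonneg_of_le_pi Metric.infDist_nonneg (by linarith [pi_pos])
      ((infDist_ΔsqE_le_one _ _).trans (by linarith [pi_gt_three]))
  have : |deriv γ₃ x| / 2 ≤ sSpeed (ΔsqE (π / 8)) γ₁ γ₂ γ₃ x := by
    refine Real.le_sqrt_of_sq_le ?_
    rw [div_pow, sq_abs]
    have : (1 / 2 : ℝ) ^ 2 ≤ _ := pow_le_pow_left₀ (by norm_num) hc 2
    nlinarith [sq_nonneg (deriv γ₁ x), sq_nonneg (deriv γ₂ x), sq_nonneg (deriv γ₃ x)]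
  linarith

lemma volume_sqCell (a : ℝ) : volume (sqCell a) = ENNReal.ofReal (2 * a) ^ 2 := by
  have h : sqCell a = (MeasurableEquiv.toLp 2 (Fin 2 → ℝ)).symm ⁻¹'
      (Set.univ.pi fun _ : Fin 2 => Icc (-a) a) := by
    ext p
    simp only [sqCell, mem_ofPred_eq, mem_preimage, mem_univ_pi, Fin.forall_fin_two]
    rfl
  rw [h, (EuclideanSpace.volume_preserving_symm_measurableEquiv_toLp (Fin 2)).measure_preimage
    (MeasurableSet.univ_pi fun _ => measurableSet_Icc).nullMeasurableSet, volume_pi_pi]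
  simp [two_mul]

lemma integral_cos_norm_sqCell_lt :
    ∫ p in sqCell (π / 8), Real.cos ‖p‖ < (π / 4) ^ 2 := by
  have hvol := volume_sqCell (π / 8)
  have hfin : IsFiniteMeasure (volume.restrict (sqCell (π / 8))) :=
    ⟨by rw [Measure.restrict_apply_univ, hvol]; exact ENNReal.pow_lt_top ENNReal.ofReal_lt_top⟩
  have hcos : Integrable (fun p : EuclideanSpace ℝ (Fin 2) => Real.cos ‖p‖)
      (volume.restrict (sqCell (π / 8))) :=
    Integrable.of_bound (by fun_prop) 1 (ae_of_all _ fun p => Real.abs_cos_le_one _)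
  have hpos : 0 < ∫ p in sqCell (π / 8), (1 - Real.cos ‖p‖) := by
    rw [integral_pos_iff_support_of_nonneg (fun p => sub_nonneg.2 (Real.cos_le_one _))
      ((integrable_const 1).sub hcos)]
    have hsub : sqCell (π / 8) \ {0} ⊆
        Function.support fun p : EuclideanSpace ℝ (Fin 2) => 1 - Real.cos ‖p‖ := by
      rintro p ⟨⟨h₀, h₁⟩, hp⟩
      have hp2 : ‖p‖ ^ 2 < (2 * π) ^ 2 := by
        rw [EuclideanSpace.real_norm_sq_eq, Fin.sum_univ_two]
        nlinarith [sq_le_sq' h₀.1 h₀.2, sq_le_sq' h₁.1 h₁.2, sq_pos_of_pos pi_pos]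
      have hlt := lt_of_pow_lt_pow_left₀ 2 (by positivity) hp2
      rw [Function.mem_support, sub_ne_zero]
      intro h
      exact hp (norm_eq_zero.1 ((Real.cos_eq_one_iff_of_lt_of_lt
        (by linarith [norm_nonneg p, pi_pos]) hlt).1 h.symm))
    refine lt_of_lt_of_le ?_ (Measure.le_restrict_apply _ _)
    refine lt_of_lt_of_le ?_ (measure_mono (subset_inter hsub sdiff_subset))
    rw [measure_sdiff_null (measure_singleton _), hvol]
    exact ENNReal.pow_pos (ENNReal.ofReal_pos.2 (by positivity)) 2
  rw [integral_sub (integrable_const 1) hcos] at hpos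
  have : ∫ _ in sqCell (π / 8), (1 : ℝ) = (π / 4) ^ 2 := by
    rw [setIntegral_const, measureReal_def, hvol, ENNReal.toReal_pow, ENNReal.toReal_ofReal
      (by positivity)]
    simp; ring
  linarith

/-- The linear part of an element of `Γ₄` is a rotation by `k π / 2`, where `k π / 2` is its
vertical displacement. -/
lemma exists_coords_of_mem_Γ₄ {g : Equiv.Perm (ℝ × ℝ × ℝ)} (hg : g ∈ Γ₄) :
    ∃ k m n c s : ℤ, (c : ℝ) = Real.cos (π / 2 * k) ∧ (s : ℝ) = Real.sin (π / 2 * k) ∧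
      ∀ x y z : ℝ, g (x, y, z) =
        (c * x - s * y + π / 2 * m, s * x + c * y + π / 2 * n, z + π / 2 * k) := by
  induction hg using Subgroup.closure_induction with
  | mem g hg =>
    rcases hg with ⟨w, ⟨k₁, k₂, k₃, rfl⟩, rfl⟩ | rfl
    · refine ⟨4 * k₃, k₁, k₂, 1, 0, ?_, ?_, fun x y z => ?_⟩
      · rw [show π / 2 * ((4 * k₃ : ℤ) : ℝ) = k₃ * (2 * π) by push_cast; ring]
        simp
      · rw [show π / 2 * ((4 * k₃ : ℤ) : ℝ) = ((2 * k₃ : ℤ) : ℝ) * π by push_cast; ring]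
        rw [Real.sin_int_mul_pi]; simp
      · simp only [Equiv.coe_addLeft, Prod.mk_add_mk, Prod.mk.injEq]
        push_cast
        refine ⟨?_, ?_, ?_⟩ <;> ring
    · refine ⟨1, 0, 0, 0, 1, by simp, by simp, fun x y z => ?_⟩
      simp [tau0Perm]
  | one => exact ⟨0, 0, 0, 1, 0, by simp, by simp, fun x y z => by simp⟩
  | mul g h _ _ hg hh =>
    obtain ⟨k, m, n, c, s, hc, hs, hg⟩ := hg
    obtain ⟨k', m', n', c', s', hc', hs', hh⟩ := hh
    refine ⟨k + k', c * m' - s * n' + m, s * m' + c * n' + n, c * c' - s * s', s * c' + c * s',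
      ?_, ?_, fun x y z => ?_⟩
    · push_cast
      rw [mul_add, Real.cos_add, hc, hs, hc', hs']
    · push_cast
      rw [mul_add, Real.sin_add, hc, hs, hc', hs']
    · rw [Equiv.Perm.mul_apply, hh, hg]
      push_cast
      simp only [Prod.mk.injEq]
      refine ⟨?_, ?_, ?_⟩ <;> ring
  | inv g _ hg =>
    obtain ⟨k, m, n, c, s, hc, hs, hg⟩ := hg
    have hcs : (c : ℝ) ^ 2 + (s : ℝ) ^ 2 = 1 := by rw [hc, hs, Real.cos_sq_add_sin_sq]
    refine ⟨-k, -(c * m + s * n), s * m - c * n, c, -s, ?_, ?_, fun x y z => ?_⟩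
    · push_cast; rw [mul_neg, Real.cos_neg, hc]
    · push_cast; rw [mul_neg, Real.sin_neg, hs]
    · rw [Equiv.Perm.inv_eq_iff_eq, hg]
      push_cast
      simp only [Prod.mk.injEq]
      refine ⟨?_, ?_, ?_⟩
      · linear_combination (-x + π / 2 * m) * hcs
      · linear_combination (-y + π / 2 * n) * hcs
      · ring

/-- Cauchy–Schwarz for the component of `q` orthogonal to the unit vector `u`. -/
lemma inner_sq_le_of_orthogonal {E : Type*} [NormedAddCommGroup E] [InnerProductSpace ℝ E]
    {u v : E} (hu : ‖u‖ = 1) (huv : inner ℝ v u = 0) (q : E) :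
    inner ℝ v q ^ 2 ≤ ‖v‖ ^ 2 * (‖q‖ ^ 2 - inner ℝ u q ^ 2) := by
  have h := abs_real_inner_le_norm v (q - inner ℝ u q • u)
  rw [inner_sub_right, inner_smul_right, huv, mul_zero, sub_zero] at h
  have h2 := pow_le_pow_left₀ (abs_nonneg _) h 2
  rw [sq_abs, mul_pow, norm_sub_sq_real, norm_smul, hu, inner_smul_right,
    real_inner_comm u q, mul_one, Real.norm_eq_abs, sq_abs] at h2
  exact h2.trans_eq (by ring)

/-- The pointwise estimate comparing the singular metric with the round metric of the sphere:
`u` is a point of `S⁴` with coordinates `(sin s · (x, y, δ) / s, cos s · (cos z, sin z))`. -/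
lemma sphere_deriv_sq_le {x y δ s σ κ c d a b ζ s' q₁ q₂ q₃ : ℝ} (hs : 0 < s)
    (hsq : s ^ 2 = x ^ 2 + y ^ 2 + δ ^ 2) (hσκ : σ ^ 2 + κ ^ 2 = 1) (hcd : c ^ 2 + d ^ 2 = 1)
    (hσ : σ ^ 2 ≤ s ^ 2) (hs' : s * s' = x * a + y * b) (hq : q₁ ^ 2 + q₂ ^ 2 + q₃ ^ 2 ≤ 1) :
    ((κ * s' * s - σ * s') / s ^ 2 * (x * q₁ + y * q₂) + σ / s * (a * q₁ + b * q₂) +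
        (-σ * s' * c - κ * d * ζ) * q₃) ^ 2 ≤
      (1 - (σ / s * (x * q₁ + y * q₂) + κ * c * q₃) ^ 2) * (a ^ 2 + b ^ 2 + κ ^ 2 * ζ ^ 2) := by
  set e := (κ * s' * s - σ * s') / s ^ 2 with he
  set r := σ / s with hr
  have hrs : r * s = σ := by rw [hr]; field_simp
  have hes : e * s = κ * s' - r * s' := by rw [he, hr]; field_simp
  clear_value e r
  let u : EuclideanSpace ℝ (Fin 5) := !₂[r * x, r * y, r * δ, κ * c, κ * d]
  let v : EuclideanSpace ℝ (Fin 5) := !₂[e * x + r * a, e * y + r * b, e * δ,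
    -σ * s' * c - κ * d * ζ, -σ * s' * d + κ * c * ζ]
  let q : EuclideanSpace ℝ (Fin 5) := !₂[q₁, q₂, 0, q₃, 0]
  have hu2 : ‖u‖ ^ 2 = 1 := by
    rw [EuclideanSpace.real_norm_sq_eq]
    simp [u, Fin.sum_univ_succ]
    linear_combination (κ ^ 2) * hcd - r ^ 2 * hsq + (r * s + σ) * hrs + hσκ
  have hu : ‖u‖ = 1 := by
    exact (pow_eq_one_iff_of_nonneg (norm_nonneg u) two_ne_zero).1 hu2
  have hvu : inner ℝ v u = 0 := by
    simp [u, v, PiLp.inner_apply, Fin.sum_univ_succ]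
    linear_combination (-r * e) * hsq - r ^ 2 * hs' + r * s * hes + κ * s' * hrs -
      (σ * s' * κ) * hcd
  have hv : ‖v‖ ^ 2 ≤ a ^ 2 + b ^ 2 + κ ^ 2 * ζ ^ 2 := by
    have hE : ‖v‖ ^ 2 = s' ^ 2 + r ^ 2 * (a ^ 2 + b ^ 2 - s' ^ 2) + κ ^ 2 * ζ ^ 2 := by
      rw [EuclideanSpace.real_norm_sq_eq]
      simp [v, Fin.sum_univ_succ]
      linear_combination (-e ^ 2) * hsq - 2 * e * r * hs' + (e * s + κ * s' - r * s') * hes +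
        2 * r * s' * hes + (σ ^ 2 * s' ^ 2 + κ ^ 2 * ζ ^ 2) * hcd + s' ^ 2 * hσκ
    have hr1 : r ^ 2 ≤ 1 := by
      rw [← hrs, mul_pow] at hσ
      exact le_of_mul_le_mul_right (by linarith) (pow_pos hs 2)
    have hs1 : s' ^ 2 ≤ a ^ 2 + b ^ 2 := by
      refine le_of_mul_le_mul_left (a := s ^ 2) ?_ (pow_pos hs 2)
      rw [← mul_pow, hs', hsq]
      nlinarith [sq_nonneg (x * b - y * a), mul_nonneg (sq_nonneg δ) (sq_nonneg a),
        mul_nonneg (sq_nonneg δ) (sq_nonneg b)]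
    rw [hE]
    nlinarith
  have hq' : ‖q‖ ^ 2 ≤ 1 := by
    rw [EuclideanSpace.real_norm_sq_eq]
    simp [q, Fin.sum_univ_succ]
    linarith
  have hin : inner ℝ v q = e * (x * q₁ + y * q₂) + r * (a * q₁ + b * q₂) +
      (-σ * s' * c - κ * d * ζ) * q₃ := by
    simp [q, v, PiLp.inner_apply, Fin.sum_univ_succ]
    ring
  have huq : inner ℝ u q = r * (x * q₁ + y * q₂) + κ * c * q₃ := by
    simp [q, u, PiLp.inner_apply, Fin.sum_univ_succ]
    ring
  have h := inner_sq_le_of_orthogonal hu hvu q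
  have h0 : inner ℝ u q ^ 2 ≤ ‖q‖ ^ 2 := by
    have := pow_le_pow_left₀ (abs_nonneg _) (abs_real_inner_le_norm u q) 2
    rwa [sq_abs, hu, one_mul] at this
  rw [← hin, ← huq]
  nlinarith [sq_nonneg ‖v‖]

/-- The vertical factor of the singular metric dominates that of the round metric centred at a
lattice point, at distance at most `2` from that point. -/
lemma cos_sq_le_cos_sq_infDist {x y s : ℝ} (m n : ℤ)
    (hs : √((x - π / 4 * m) ^ 2 + (y - π / 4 * n) ^ 2) ≤ s) (hs2 : s ≤ 2) :
    Real.cos s ^ 2 ≤ Real.cos (Metric.infDist (pt2 x y) (ΔsqE (π / 8))) ^ 2 := by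
  set d := Metric.infDist (pt2 x y) (ΔsqE (π / 8)) with hd
  have h0 : 0 ≤ d := Metric.infDist_nonneg
  have h1 : d ≤ 1 := infDist_ΔsqE_le_one x y
  have hds : d ≤ s := (infDist_ΔsqE_le_dist x y m n).trans hs
  have hπ := pi_gt_three
  refine sq_le_sq' ?_ (Real.cos_le_cos_of_nonneg_of_le_pi h0 (by linarith) hds)
  rw [neg_le, ← Real.cos_pi_sub]
  exact Real.cos_le_cos_of_nonneg_of_le_pi h0 (by linarith) (by linarith)

/-- Bound for the inner product of `q` with a vector of norm at most `1`. -/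
lemma cauchy_schwarz_three {a b c q₁ q₂ q₃ : ℝ} (h : a ^ 2 + b ^ 2 + c ^ 2 ≤ 1) :
    (a * q₁ + b * q₂ + c * q₃) ^ 2 ≤ q₁ ^ 2 + q₂ ^ 2 + q₃ ^ 2 := by
  have : (a ^ 2 + b ^ 2 + c ^ 2) * (q₁ ^ 2 + q₂ ^ 2 + q₃ ^ 2) ≤
      1 * (q₁ ^ 2 + q₂ ^ 2 + q₃ ^ 2) := by gcongr
  nlinarith [sq_nonneg (a * q₂ - b * q₁), sq_nonneg (a * q₃ - c * q₁), sq_nonneg (b * q₃ - c * q₂)]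

lemma HasDerivAt.sphere_inner {s X Y Z : ℝ → ℝ} {s' a b ζ t : ℝ} (ds : HasDerivAt s s' t)
    (dX : HasDerivAt X a t) (dY : HasDerivAt Y b t) (dZ : HasDerivAt Z ζ t) (hs : s t ≠ 0)
    (q₁ q₂ q₃ : ℝ) :
    HasDerivAt (fun t => Real.sin (s t) / s t * (X t * q₁ + Y t * q₂) +
        Real.cos (s t) * Real.cos (Z t) * q₃)
      ((Real.cos (s t) * s' * s t - Real.sin (s t) * s') / s t ^ 2 * (X t * q₁ + Y t * q₂) +
        Real.sin (s t) / s t * (a * q₁ + b * q₂) +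
        (-Real.sin (s t) * s' * Real.cos (Z t) - Real.cos (s t) * Real.sin (Z t) * ζ) * q₃) t :=
  (((ds.sin.div ds hs).mul ((dX.mul_const q₁).add (dY.mul_const q₂))).add
    (((ds.cos).mul dZ.cos).mul_const q₃)).congr_deriv (by
      simp only [Pi.add_apply, Pi.div_apply]
      ring)

/-- Lower bound for the length of a curve realising a screw motion by a quarter turn about a lattice
point, for curves staying close to that point. -/
lemma arcsin_one_sub_sq_le_integral_sSpeed {γ₁ γ₂ γ₃ : ℝ → ℝ} (h₁ : PC1 γ₁) (h₂ : PC1 γ₂) (h₃ : PC1 γ₃)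
    (m n : ℤ) {δ : ℝ} (hδ : 0 < δ)
    (hclose : ∀ t ∈ Icc (0 : ℝ) 1,
      (γ₁ t - π / 4 * m) ^ 2 + (γ₂ t - π / 4 * n) ^ 2 + δ ^ 2 ≤ 2 ^ 2)
    (hxy : (γ₁ 1 - π / 4 * m) * (γ₁ 0 - π / 4 * m) +
      (γ₂ 1 - π / 4 * n) * (γ₂ 0 - π / 4 * n) = 0)
    (hz : Real.cos (γ₃ 1 - γ₃ 0) = 0) :
    Real.arcsin (1 - δ ^ 2) ≤ ∫ t in (0 : ℝ)..1, sSpeed (ΔsqE (π / 8)) γ₁ γ₂ γ₃ t := by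
  set X : ℝ → ℝ := fun t => γ₁ t - π / 4 * m with hX
  set Y : ℝ → ℝ := fun t => γ₂ t - π / 4 * n with hY
  set Z : ℝ → ℝ := fun t => γ₃ t - γ₃ 0 with hZ
  set s : ℝ → ℝ := fun t => √(X t ^ 2 + Y t ^ 2 + δ ^ 2) with hs
  have hsq : ∀ t, s t ^ 2 = X t ^ 2 + Y t ^ 2 + δ ^ 2 := fun t => Real.sq_sqrt (by positivity)
  have hpos : ∀ t, 0 < s t := fun t => Real.sqrt_pos.2 (by positivity)
  have hs2 : ∀ t ∈ Icc (0 : ℝ) 1, s t ≤ 2 := fun t ht =>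
    le_of_sq_le_sq ((hsq t).trans_le (hclose t ht)) (by norm_num)
  have hsin : ∀ t, Real.sin (s t) ^ 2 ≤ s t ^ 2 := fun t =>
    sq_le_sq.2 Real.abs_sin_le_abs
  set q₁ := Real.sin (s 0) / s 0 * X 0 with hq₁
  set q₂ := Real.sin (s 0) / s 0 * Y 0 with hq₂
  set q₃ := Real.cos (s 0) with hq₃
  have hq : q₁ ^ 2 + q₂ ^ 2 + q₃ ^ 2 = 1 - (Real.sin (s 0) / s 0) ^ 2 * δ ^ 2 := by
    have e : (Real.sin (s 0) / s 0) ^ 2 * s 0 ^ 2 = Real.sin (s 0) ^ 2 := by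
      have := (hpos 0).ne'
      field_simp
    rw [hsq 0] at e
    linear_combination e + Real.sin_sq_add_cos_sq (s 0)
  have hsinpos : 0 < Real.sin (s 0) :=
    Real.sin_pos_of_pos_of_lt_pi (hpos 0) ((hs2 0 (by simp)).trans_lt (by linarith [pi_gt_three]))
  have hqlt : q₁ ^ 2 + q₂ ^ 2 + q₃ ^ 2 < 1 := by
    have : 0 < (Real.sin (s 0) / s 0) ^ 2 * δ ^ 2 := by have := hpos 0; positivity
    linarith
  set f : ℝ → ℝ := fun t => Real.sin (s t) / s t * (X t * q₁ + Y t * q₂) +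
    Real.cos (s t) * Real.cos (Z t) * q₃ with hf
  have hf1 : ∀ t, f t ^ 2 < 1 := by
    intro t
    refine lt_of_le_of_lt ?_ hqlt
    have e : (Real.sin (s t) / s t) ^ 2 * s t ^ 2 = Real.sin (s t) ^ 2 := by
      have := (hpos t).ne'
      field_simp
    have e2 : (Real.sin (s t) / s t) ^ 2 * (X t ^ 2 + Y t ^ 2) + Real.cos (s t) ^ 2 ≤ 1 := by
      rw [hsq t] at e
      linarith [sq_nonneg (Real.sin (s t) / s t * δ), Real.sin_sq_add_cos_sq (s t)]
    have := cauchy_schwarz_three (a := Real.sin (s t) / s t * X t) (b := Real.sin (s t) / s t * Y t)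
      (c := Real.cos (s t) * Real.cos (Z t)) (q₁ := q₁) (q₂ := q₂) (q₃ := q₃)
      (by
        have := mul_le_of_le_one_right (sq_nonneg (Real.cos (s t))) (Real.cos_sq_le_one (Z t))
        linarith)
    refine le_trans (le_of_eq ?_) this
    simp only [hf]
    ring
  have hfc : ContinuousOn f (Icc 0 1) := by
    have cX : ContinuousOn X (Icc 0 1) := h₁.continuousOn.sub continuousOn_const
    have cY : ContinuousOn Y (Icc 0 1) := h₂.continuousOn.sub continuousOn_const
    have cZ : ContinuousOn Z (Icc 0 1) := h₃.continuousOn.sub continuousOn_const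
    have cs : ContinuousOn s (Icc 0 1) :=
      (((cX.pow 2).add (cY.pow 2)).add continuousOn_const).sqrt
    have : ContinuousOn (fun t => Real.sin (s t) / s t) (Icc 0 1) :=
      (Real.continuous_sin.comp_continuousOn cs).div cs fun t _ => (hpos t).ne'
    exact (this.mul ((cX.mul continuousOn_const).add (cY.mul continuousOn_const))).add
      (((Real.continuous_cos.comp_continuousOn cs).mul
        (Real.continuous_cos.comp_continuousOn cZ)).mul continuousOn_const)
  have key := abs_sub_le_integral_sSpeed (Δ := ΔsqE (π / 8)) (F := fun t => Real.arcsin (f t))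
    (C := 1) h₁ h₂ h₃ le_rfl zero_le_one le_rfl (Real.continuous_arcsin.comp_continuousOn hfc) (by
      intro t ht d₁ d₂ d₃
      have dX : HasDerivAt X (deriv γ₁ t) t := d₁.hasDerivAt.sub_const _
      have dY : HasDerivAt Y (deriv γ₂ t) t := d₂.hasDerivAt.sub_const _
      have dZ : HasDerivAt Z (deriv γ₃ t) t := d₃.hasDerivAt.sub_const _
      set s' := (X t * deriv γ₁ t + Y t * deriv γ₂ t) / s t with hs'
      have ds : HasDerivAt s s' t := by
        have h2 : HasDerivAt (fun t => X t ^ 2 + Y t ^ 2 + δ ^ 2)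
            (2 * (X t * deriv γ₁ t + Y t * deriv γ₂ t)) t :=
          (((dX.pow 2).add (dY.pow 2)).add_const (δ ^ 2)).congr_deriv (by simp; ring)
        refine (h2.sqrt (by rw [← hsq t]; exact (pow_pos (hpos t) 2).ne')).congr_deriv ?_
        exact mul_div_mul_left _ _ two_ne_zero
      have df := ds.sphere_inner dX dY dZ (hpos t).ne' q₁ q₂ q₃
      have hlt := abs_lt.1 ((sq_lt_one_iff_abs_lt_one _).1 (hf1 t))
      have dF := (Real.hasDerivAt_arcsin hlt.1.ne' hlt.2.ne).comp t df
      refine ⟨dF.differentiableAt, ?_⟩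
      have hdF : deriv (fun t => Real.arcsin (f t)) t = _ := dF.deriv
      have hle := sphere_deriv_sq_le (δ := δ) (ζ := deriv γ₃ t) (hpos t) (hsq t)
        (Real.sin_sq_add_cos_sq (s t)) (Real.cos_sq_add_sin_sq (Z t)) (hsin t)
        (mul_div_cancel₀ _ (hpos t).ne' : s t * s' = X t * deriv γ₁ t + Y t * deriv γ₂ t) hqlt.le
      have h1 : 0 < 1 - f t ^ 2 := by linarith [hf1 t]
      have hcos := cos_sq_le_cos_sq_infDist (x := γ₁ t) (y := γ₂ t) m n
        (Real.sqrt_le_sqrt (le_add_of_nonneg_right (sq_nonneg δ)) : _ ≤ s t) (hs2 t ht)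
      rw [hdF, abs_mul, abs_of_pos (by positivity), one_div, one_mul,
        inv_mul_le_iff₀ (by positivity), sSpeed, ← Real.sqrt_mul h1.le]
      refine Real.abs_le_sqrt (hle.trans (mul_le_mul_of_nonneg_left ?_ h1.le))
      gcongr)
  have hf_one : f 1 = 0 := by
    simp only [hf, hq₁, hq₂, hZ, hz]
    linear_combination (Real.sin (s 1) / s 1 * (Real.sin (s 0) / s 0)) * hxy
  have hf_zero : f 0 = 1 - (Real.sin (s 0) / s 0) ^ 2 * δ ^ 2 := by
    rw [← hq]
    simp only [hf, hZ, sub_self, Real.cos_zero]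
    rw [← hq₃]
    linear_combination (-q₁) * hq₁ - q₂ * hq₂
  rw [hf_one, Real.arcsin_zero, one_mul, zero_sub, abs_neg] at key
  refine le_trans (Real.monotone_arcsin ?_) ((le_abs_self _).trans key)
  have : (Real.sin (s 0) / s 0) ^ 2 ≤ 1 := by
    rw [div_pow, div_le_one (pow_pos (hpos 0) 2)]
    exact hsin 0
  rw [hf_zero]
  linarith [mul_le_of_le_one_left (sq_nonneg δ) this]

/-- A curve realising a screw motion by a quarter turn about a lattice point has length at least
`π / 2`. -/
lemma pi_div_two_le_integral_sSpeed_of_screw {γ₁ γ₂ γ₃ : ℝ → ℝ} (h₁ : PC1 γ₁) (h₂ : PC1 γ₂)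
    (h₃ : PC1 γ₃) (m n : ℤ) {ε : ℝ} (hε : ε ^ 2 = 1)
    (hx : γ₁ 1 - π / 4 * m = -ε * (γ₂ 0 - π / 4 * n))
    (hy : γ₂ 1 - π / 4 * n = ε * (γ₁ 0 - π / 4 * m))
    (hz : Real.cos (γ₃ 1 - γ₃ 0) = 0) :
    π / 2 ≤ ∫ t in (0 : ℝ)..1, sSpeed (ΔsqE (π / 8)) γ₁ γ₂ γ₃ t := by
  by_contra! hL
  set L := ∫ t in (0 : ℝ)..1, sSpeed (ΔsqE (π / 8)) γ₁ γ₂ γ₃ t with hLdef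
  have hL0 : 0 ≤ L := intervalIntegral.integral_nonneg zero_le_one fun t _ => sSpeed_nonneg ..
  have hLlt : L < 1.5708 := by linarith [pi_lt_d4]
  set u := γ₁ 0 - π / 4 * m with hu
  set v := γ₂ 0 - π / 4 * n with hv
  have hp : 2 * (u ^ 2 + v ^ 2) ≤ L ^ 2 := by
    have := planar_dist_le_integral_sSpeed (ΔsqE (π / 8)) h₁ h₂ h₃ le_rfl zero_le_one le_rfl
    rw [Real.sqrt_le_left hL0] at this
    have e₁ : γ₁ 1 - γ₁ 0 = -ε * v - u := by rw [← hx, hu]; ring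
    have e₂ : γ₂ 1 - γ₂ 0 = ε * u - v := by rw [← hy, hv]; ring
    rw [e₁, e₂] at this
    nlinarith
  have hclose : ∀ t ∈ Icc (0 : ℝ) 1,
      (γ₁ t - π / 4 * m) ^ 2 + (γ₂ t - π / 4 * n) ^ 2 ≤ 1.9 ^ 2 := by
    intro t ht
    have hI := intervalIntegrable_sSpeed (ΔsqE (π / 8)) h₁ h₂ h₃
    have hadd := intervalIntegral.integral_add_adjacent_intervals
      (hI.mono_set (by rw [uIcc_of_le ht.1, uIcc_of_le zero_le_one]; exact Icc_subset_Icc_right ht.2))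
      (hI.mono_set (by rw [uIcc_of_le ht.2, uIcc_of_le zero_le_one]; exact Icc_subset_Icc_left ht.1))
    have d₁ := planar_dist_le_integral_sSpeed (ΔsqE (π / 8)) h₁ h₂ h₃ le_rfl ht.1 ht.2
    have d₂ := planar_dist_le_integral_sSpeed (ΔsqE (π / 8)) h₁ h₂ h₃ ht.1 ht.2 le_rfl
    rw [← pt2_dist] at d₁ d₂
    have hnorm : ∀ a b : ℝ, (a - π / 4 * m) ^ 2 + (b - π / 4 * n) ^ 2 = u ^ 2 + v ^ 2 →
        dist (pt2 a b) (pt2 (π / 4 * m) (π / 4 * n)) ≤ 1.111 := by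
      intro a b hab
      rw [pt2_dist, hab]
      refine Real.sqrt_le_iff.2 ⟨by norm_num, ?_⟩
      nlinarith
    have hP := hnorm (γ₁ 0) (γ₂ 0) rfl
    have hR := hnorm (γ₁ 1) (γ₂ 1) (by
      rw [hx, hy]
      linear_combination (u ^ 2 + v ^ 2) * hε)
    have t₁ := dist_triangle (pt2 (γ₁ t) (γ₂ t)) (pt2 (γ₁ 0) (γ₂ 0)) (pt2 (π / 4 * m) (π / 4 * n))
    have t₂ := dist_triangle_left (pt2 (γ₁ t) (γ₂ t)) (pt2 (π / 4 * m) (π / 4 * n))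
      (pt2 (γ₁ 1) (γ₂ 1))
    have hQ : dist (pt2 (γ₁ t) (γ₂ t)) (pt2 (π / 4 * m) (π / 4 * n)) ≤ 1.9 := by linarith
    rw [pt2_dist] at hQ
    exact (Real.sqrt_le_left (by norm_num)).1 hQ
  set δ := √(min (0.1 : ℝ) ((1 - Real.sin L) / 2)) with hδ
  have hsin : Real.sin L < 1 := by
    rw [← Real.sin_pi_div_two]
    exact Real.sin_lt_sin_of_lt_of_le_pi_div_two (by linarith [pi_pos]) le_rfl hL
  have hmin : 0 < min (0.1 : ℝ) ((1 - Real.sin L) / 2) := lt_min (by norm_num) (by linarith)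
  have hδ2 : δ ^ 2 = min (0.1 : ℝ) ((1 - Real.sin L) / 2) := Real.sq_sqrt hmin.le
  have h := arcsin_one_sub_sq_le_integral_sSpeed h₁ h₂ h₃ m n (Real.sqrt_pos.2 hmin)
    (fun t ht => by
      have := min_le_left (0.1 : ℝ) ((1 - Real.sin L) / 2)
      rw [← hδ, hδ2]
      linarith [hclose t ht])
    (by rw [hx, hy]; ring) hz
  rw [← hδ, hδ2, ← hLdef, Real.arcsin_le_iff_le_sin' ⟨by linarith [pi_pos], hL⟩] at h
  linarith [min_le_right (0.1 : ℝ) ((1 - Real.sin L) / 2)]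

/-- Every curve joining a point to its image under a nontrivial element of `Γ₄` has length at
least `π / 2`. -/
lemma pi_div_two_le_sLen {g : Equiv.Perm (ℝ × ℝ × ℝ)} (hg : g ∈ Γ₄) (hg1 : g ≠ 1)
    {γ₁ γ₂ γ₃ : ℝ → ℝ} (h₁ : PC1 γ₁) (h₂ : PC1 γ₂) (h₃ : PC1 γ₃)
    (h : (γ₁ 1, γ₂ 1, γ₃ 1) = g (γ₁ 0, γ₂ 0, γ₃ 0)) :
    π / 2 ≤ sLen (ΔsqE (π / 8)) γ₁ γ₂ γ₃ := by
  obtain ⟨k, m, n, c, s, hc, hs, hgf⟩ := exists_coords_of_mem_Γ₄ hg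
  rw [hgf] at h
  simp only [Prod.mk.injEq] at h
  obtain ⟨hx, hy, hz⟩ := h
  change _ ≤ ∫ t in (0 : ℝ)..1, sSpeed (ΔsqE (π / 8)) γ₁ γ₂ γ₃ t
  have screw : ∀ ε : ℤ, ε ^ 2 = 1 → k = ε →
      π / 2 ≤ ∫ t in (0 : ℝ)..1, sSpeed (ΔsqE (π / 8)) γ₁ γ₂ γ₃ t := by
    intro ε hε hk
    have hcos : Real.cos (π / 2 * k) = 0 ∧ Real.sin (π / 2 * k) = ε := by
      rcases mul_self_eq_one_iff.1 ((sq ε).symm.trans hε) with rfl | rfl <;> simp [hk]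
    rw [hcos.1] at hc
    rw [hcos.2] at hs
    have hεR : (ε : ℝ) ^ 2 = 1 := by exact_mod_cast hε
    refine pi_div_two_le_integral_sSpeed_of_screw h₁ h₂ h₃ (m - ε * n) (n + ε * m) hεR ?_ ?_ ?_
    · rw [hx, hc, hs]; push_cast
      linear_combination (-(π / 4) * m) * hεR
    · rw [hy, hc, hs]; push_cast
      linear_combination (-(π / 4) * n) * hεR
    · rw [hz, add_sub_cancel_left, hcos.1]
  by_cases hk0 : k = 0
  · subst hk0
    simp only [Int.cast_zero, mul_zero, Real.cos_zero, Real.sin_zero] at hc hs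
    have hmn : (1 : ℝ) ≤ (m : ℝ) ^ 2 + (n : ℝ) ^ 2 := by
      have : (m, n) ≠ (0, 0) := by
        intro h0
        simp only [Prod.mk.injEq] at h0
        refine hg1 (Equiv.ext fun p => ?_)
        rw [hgf, hc, hs, h0.1, h0.2]
        simp
      have hZ : 1 ≤ m ^ 2 + n ^ 2 := by
        by_contra! hlt
        have hm : m = 0 := by nlinarith
        have hn : n = 0 := by nlinarith
        exact this (by rw [hm, hn])
      exact_mod_cast hZ
    refine le_trans (Real.le_sqrt_of_sq_le ?_)
      (planar_dist_le_integral_sSpeed (ΔsqE (π / 8)) h₁ h₂ h₃ le_rfl zero_le_one le_rfl)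
    rw [hx, hy, hc, hs]
    nlinarith [sq_nonneg π]
  by_cases hk1 : k = 1
  · exact screw 1 (by norm_num) hk1
  by_cases hk2 : k = -1
  · exact screw (-1) (by norm_num) hk2
  have habs : (2 : ℝ) ≤ |(k : ℝ)| := by
    have : 2 ≤ |k| := by
      rw [le_abs]
      omega
    exact_mod_cast this
  have hv := vertical_dist_le_integral_sSpeed h₁ h₂ h₃
  rw [hz, add_sub_cancel_left, abs_mul, abs_of_pos (by positivity)] at hv
  nlinarith [pi_pos]

/-- for `a = π/8`, (i) the systole of `(C₄, g_c)` equals `π/2`, and (ii) with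
`V = 2π∫_{[−π/8,π/8]²} cos‖p‖ dp` the volume of `(C₄, g_c)`, one has `(π/2)³ > V`; hence
the systolic ratio of `(C₄, g_c)` exceeds `1`, the optimal flat systolic ratio on `C₄`. -/
theorem C4_singular_beats_flat :
    sInf {L : ℝ | ∃ g ∈ Γ₄, g ≠ 1 ∧ ∃ γ₁ γ₂ γ₃ : ℝ → ℝ,
        PC1 γ₁ ∧ PC1 γ₂ ∧ PC1 γ₃ ∧
        (γ₁ 1, γ₂ 1, γ₃ 1) = g (γ₁ 0, γ₂ 0, γ₃ 0) ∧
        L = sLen (ΔsqE (π / 8)) γ₁ γ₂ γ₃} = π / 2 ∧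
    (π / 2) ^ 3 > 2 * π * ∫ p in sqCell (π / 8), Real.cos ‖p‖ := by
  refine ⟨IsLeast.csInf_eq ⟨?_, ?_⟩, ?_⟩
  · refine ⟨Equiv.addLeft (π / 2, 0, 0), Subgroup.subset_closure (Or.inl ⟨_, ⟨1, 0, 0, ?_⟩, rfl⟩),
      fun h => ?_, fun t => π / 2 * t, fun _ => 0, fun _ => 0, .of_contDiff (by fun_prop),
      .of_contDiff (by fun_prop), .of_contDiff (by fun_prop), ?_, ?_⟩
    · simp
    · have := congrArg Prod.fst (DFunLike.congr_fun h (0, 0, 0))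
      simp [pi_ne_zero] at this
    · simp
    · simp [sLen, Real.sqrt_sq pi_div_two_pos.le]
  · rintro L ⟨g, hg, hg1, γ₁, γ₂, γ₃, h₁, h₂, h₃, h, rfl⟩
    exact pi_div_two_le_sLen hg hg1 h₁ h₂ h₃ h
  · calc 2 * π * ∫ p in sqCell (π / 8), Real.cos ‖p‖ < 2 * π * (π / 4) ^ 2 :=
        mul_lt_mul_of_pos_left integral_cos_norm_sqCell_lt two_pi_pos
      _ = (π / 2) ^ 3 := by ring

end
end

section
/- Let Λ ⊂ ℝ² be a lattice (discrete cocompact subgroup), let s = min{ ‖v‖ : v ∈ Λ, v ≠ 0 } be the length of its shortest nonzero vector, and let d be its covolume. Then for every t > 0, min(t, s)³ ≤ (2/√3) · t · d. Consequently, every flat Riemannian metric on the 3-dimensional orientable Bieberbach manifold C₂ has systolic ratio Sys³/Vol at most 2/√3. -/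
open Real

noncomputable section

theorem EuclideanSpace.det_ne_zero_of_linearIndependent
    {u v : EuclideanSpace ℝ (Fin 2)} (huv : LinearIndependent ℝ ![u, v]) :
    u 0 * v 1 - u 1 * v 0 ≠ 0 := by
  intro h
  rw [LinearIndependent.pair_iff] at huv
  have h₁ := huv (v 1) (-(u 1)) (by ext i; fin_cases i <;> simp <;> linarith)
  have h₀ := huv (v 0) (-(u 0)) (by ext i; fin_cases i <;> simp <;> linarith)
  have hv : v = 0 := by ext i; fin_cases i <;> simp [h₀.1, h₁.1]
  simpa using (huv 0 1 (by simp [hv])).2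

theorem EuclideanSpace.norm_sq_eq_fin_two (x : EuclideanSpace ℝ (Fin 2)) :
    ‖x‖ ^ 2 = x 0 ^ 2 + x 1 ^ 2 := by
  simp [EuclideanSpace.real_norm_sq_eq, Fin.sum_univ_two]

/-- The Lagrange identity bounds a shortest vector `w` by the determinant of a basis `w, x`,
since `x` may be translated by a multiple of `w` so that its component along `w` is at most
half of `w`. -/
theorem EuclideanSpace.three_mul_norm_pow_four_le_of_forall_norm_le
    {w x : EuclideanSpace ℝ (Fin 2)}
    (hmin : ∀ k : ℤ, ‖w‖ ≤ ‖x - (k : ℝ) • w‖) :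
    3 * ‖w‖ ^ 4 ≤ 4 * (w 0 * x 1 - w 1 * x 0) ^ 2 := by
  rcases eq_or_ne w 0 with rfl | hw
  · simp
  have hpos : 0 < ‖w‖ ^ 2 := by positivity
  set c : ℝ := (w 0 * x 0 + w 1 * x 1) / ‖w‖ ^ 2 with hc
  have hcw : c * ‖w‖ ^ 2 = w 0 * x 0 + w 1 * x 1 := div_mul_cancel₀ _ hpos.ne'
  have hround : (c - round c) ^ 2 ≤ 1 / 4 := by
    have h := abs_le.mp (abs_sub_round c)
    nlinarith [h.1, h.2]
  have hle : ‖w‖ ^ 2 ≤ ‖x - (round c : ℝ) • w‖ ^ 2 := by gcongr; exact hmin _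
  have hlagrange : ‖w‖ ^ 2 * ‖x - (round c : ℝ) • w‖ ^ 2 =
      (c - round c) ^ 2 * (‖w‖ ^ 2) ^ 2 + (w 0 * x 1 - w 1 * x 0) ^ 2 := by
    have : (c - round c) ^ 2 * (‖w‖ ^ 2) ^ 2 =
        (w 0 * x 0 + w 1 * x 1 - round c * ‖w‖ ^ 2) ^ 2 := by rw [← hcw]; ring
    rw [this, norm_sq_eq_fin_two, norm_sq_eq_fin_two]
    simp only [PiLp.sub_apply, PiLp.smul_apply, smul_eq_mul]
    ring
  nlinarith [mul_le_mul_of_nonneg_left hle hpos.le,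
    mul_le_mul_of_nonneg_right hround (sq_nonneg (‖w‖ ^ 2))]

/-- The coordinates of a shortest nonzero lattice vector are coprime. -/
theorem isCoprime_of_forall_norm_le {E : Type*} [NormedAddCommGroup E] [NormedSpace ℝ E]
    {u v : E} {m n : ℤ} (hne : (m : ℝ) • u + (n : ℝ) • v ≠ 0)
    (hmin : ∀ p q : ℤ, (p : ℝ) • u + (q : ℝ) • v ≠ 0 →
      ‖(m : ℝ) • u + (n : ℝ) • v‖ ≤ ‖(p : ℝ) • u + (q : ℝ) • v‖) :
    IsCoprime m n := by
  rw [Int.isCoprime_iff_gcd_eq_one]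
  obtain ⟨p, hp⟩ := Int.gcd_dvd_left m n
  obtain ⟨q, hq⟩ := Int.gcd_dvd_right m n
  set g := Int.gcd m n
  have hfac : (m : ℝ) • u + (n : ℝ) • v = (g : ℝ) • ((p : ℝ) • u + (q : ℝ) • v) := by
    rw [hp, hq]
    push_cast
    module
  have hne' : (p : ℝ) • u + (q : ℝ) • v ≠ 0 := fun h ↦ hne (by rw [hfac, h, smul_zero])
  have hg : g ≠ 0 := fun h ↦ hne (by rw [hfac, h]; simp)
  have hle := hmin p q hne'
  rw [hfac, norm_smul, Real.norm_natCast] at hle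
  have : (g : ℝ) ≤ 1 := le_of_mul_le_mul_right (by simpa using hle) (norm_pos_iff.mpr hne')
  have : g ≤ 1 := by exact_mod_cast this
  omega

/-- Hermite's inequality for planar lattices. -/
theorem EuclideanSpace.norm_sq_le_two_div_sqrt_three_mul_abs_det
    {u v : EuclideanSpace ℝ (Fin 2)} (huv : LinearIndependent ℝ ![u, v]) {m n : ℤ}
    (hne : (m : ℝ) • u + (n : ℝ) • v ≠ 0)
    (hmin : ∀ p q : ℤ, (p : ℝ) • u + (q : ℝ) • v ≠ 0 →
      ‖(m : ℝ) • u + (n : ℝ) • v‖ ≤ ‖(p : ℝ) • u + (q : ℝ) • v‖) :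
    ‖(m : ℝ) • u + (n : ℝ) • v‖ ^ 2 ≤ 2 / √3 * |u 0 * v 1 - u 1 * v 0| := by
  obtain ⟨a, b, hab⟩ := isCoprime_of_forall_norm_le hne hmin
  have hab' : (a : ℝ) * m + b * n = 1 := by exact_mod_cast hab
  set w := (m : ℝ) • u + (n : ℝ) • v with hw
  set x := ((-b : ℤ) : ℝ) • u + (a : ℝ) • v with hx
  have hdet : w 0 * x 1 - w 1 * x 0 = u 0 * v 1 - u 1 * v 0 := by
    simp only [hw, hx, PiLp.add_apply, PiLp.smul_apply, smul_eq_mul]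
    push_cast
    linear_combination (u 0 * v 1 - u 1 * v 0) * hab'
  have hbound : 3 * ‖w‖ ^ 4 ≤ 4 * (w 0 * x 1 - w 1 * x 0) ^ 2 := by
    refine three_mul_norm_pow_four_le_of_forall_norm_le fun k ↦ ?_
    have hxk : x - (k : ℝ) • w =
        ((-b - k * m : ℤ) : ℝ) • u + ((a - k * n : ℤ) : ℝ) • v := by
      rw [hw, hx]
      push_cast
      module
    rw [hxk]
    refine hmin _ _ fun h ↦ det_ne_zero_of_linearIndependent huv ?_
    rw [← hdet, sub_eq_zero.mp (hxk.trans h)]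
    simp only [PiLp.smul_apply, smul_eq_mul]
    ring
  rw [hdet] at hbound
  rw [div_mul_eq_mul_div, le_div_iff₀ (by positivity)]
  refine le_of_sq_le_sq ?_ (by positivity)
  rw [mul_pow, mul_pow, sq_abs, Real.sq_sqrt (by norm_num)]
  linarith

/-- let `Λ = ℤu + ℤv ⊂ ℝ²` be a lattice, `s` the length of its shortest
nonzero vector, and `d = |det(u,v)|` its covolume.  Then for every `t > 0` one has
`min(t, s)³ ≤ (2/√3)·t·d`.  Consequently every flat metric on the orientable Bieberbach
manifold `C₂` — with systole `min(|a₃|/2, s)` and volume `(1/2)|a₃|d` — has systolic ratio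
at most `2/√3`. -/
theorem flat_C2_systolic_ratio_le
    (u v : EuclideanSpace ℝ (Fin 2)) (huv : LinearIndependent ℝ ![u, v])
    (Λ : Set (EuclideanSpace ℝ (Fin 2)))
    (hΛ : Λ = {p | ∃ m n : ℤ, p = (m : ℝ) • u + (n : ℝ) • v})
    (s : ℝ) (hs : IsLeast {r : ℝ | ∃ w ∈ Λ, w ≠ 0 ∧ r = ‖w‖} s)
    (d : ℝ) (hd : d = |u 0 * v 1 - u 1 * v 0|) :
    (∀ t : ℝ, 0 < t → min t s ^ 3 ≤ 2 / Real.sqrt 3 * t * d) ∧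
    ∀ c : ℝ, 0 < c → min (c / 2) s ^ 3 / (1 / 2 * c * d) ≤ 2 / Real.sqrt 3 := by
  obtain ⟨⟨w, hwΛ, hw, rfl⟩, hleast⟩ := hs
  subst hΛ hd
  obtain ⟨m, n, rfl⟩ := hwΛ
  have hermite := EuclideanSpace.norm_sq_le_two_div_sqrt_three_mul_abs_det huv hw
    fun p q h ↦ hleast ⟨_, ⟨p, q, rfl⟩, h, rfl⟩
  set s := ‖(m : ℝ) • u + (n : ℝ) • v‖
  set d := |u 0 * v 1 - u 1 * v 0|
  have hcube : ∀ t : ℝ, 0 < t → min t s ^ 3 ≤ 2 / √3 * t * d := fun t ht ↦ by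
    have hnonneg : 0 ≤ min t s := le_min ht.le (norm_nonneg _)
    calc min t s ^ 3 = min t s * min t s ^ 2 := by ring
      _ ≤ t * s ^ 2 := by gcongr <;> simp
      _ ≤ t * (2 / √3 * d) := by gcongr
      _ = 2 / √3 * t * d := by ring
  refine ⟨hcube, fun c hc ↦ div_le_of_le_mul₀ (by positivity) (by positivity) ?_⟩
  linarith [hcube (c / 2) (by positivity)]

end
end
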